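/- arXiv:1707.07293 — 3 statements merged into one kernel-verified Lean document; each statement's English description precedes it below -/
import Mathlib

section
/- For every finite group G, α(G) ≤ 1/2 + I(G)/(2|G|), equivalently I(G)/|G| ≥ 2α(G) − 1. In particular, α(G) = 1 if and only if G is an elementary abelian 2-group. -/
open scoped Classical

/-- The number of cyclic subgroups of a group. -/
noncomputable def numCyclic (G : Type*) [Group G] : ℕ :=
  Nat.card {H : Subgroup G // IsCyclic (↥H)}

/-- `alpha G = c(G) / |G|`, the number of cyclic subgroups divided by the order. -/
noncomputable def alpha (G : Type*) [Group G] : ℚ :=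
  (numCyclic G : ℚ) / (Nat.card G : ℚ)

/-- Twice the number of cyclic subgroups is at most `|G| + I(G)`: a cyclic subgroup with generator
`g` accounts for `g` and `g⁻¹` when these differ, and for `g` counted twice when `g ^ 2 = 1`. -/
theorem two_mul_numCyclic_le (G : Type*) [Group G] [Finite G] :
    2 * numCyclic G ≤ Nat.card G + Nat.card {g : G // g ^ 2 = 1} := by
  have hgen (H : {H : Subgroup G // IsCyclic (↥H)}) : ∃ g : G, Subgroup.zpowers g = H.1 :=
    (Subgroup.isCyclic_iff_exists_zpowers_eq_top H.1).mp H.2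
  choose gen hgen using hgen
  have gen_inj : Function.Injective gen := fun H K h => by
    rw [Subtype.ext_iff, ← hgen, ← hgen, h]
  have gen_eq_of_eq_inv {H K} (h : gen H = (gen K)⁻¹) : H = K := by
    rw [Subtype.ext_iff, ← hgen, ← hgen, h, Subgroup.zpowers_inv]
  let f : {H : Subgroup G // IsCyclic (↥H)} ⊕ {H : Subgroup G // IsCyclic (↥H)} →
      G ⊕ {g : G // g ^ 2 = 1} :=
    Sum.elim (fun H => Sum.inl (gen H))
      (fun H => if h : gen H ^ 2 = 1 then Sum.inr ⟨gen H, h⟩ else Sum.inl (gen H)⁻¹)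
  have ne_of_left_right (H K) : f (.inl H) ≠ f (.inr K) := by
    intro h
    simp only [f, Sum.elim_inl, Sum.elim_inr] at h
    split_ifs at h with hK
    have h' := Sum.inl_injective h
    obtain rfl := gen_eq_of_eq_inv h'
    exact hK (by rw [pow_two, mul_eq_one_iff_eq_inv, ← h'])
  have hf : Function.Injective f := by
    rintro (H | H) (K | K) h
    · exact congrArg _ (gen_inj (Sum.inl_injective h))
    · exact (ne_of_left_right H K h).elim
    · exact (ne_of_left_right K H h.symm).elim
    · simp only [f, Sum.elim_inr] at h
      refine congrArg _ (gen_inj ?_)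
      split_ifs at h
      · exact congrArg Subtype.val (Sum.inr_injective h)
      · exact inv_injective (Sum.inl_injective h)
  have := Nat.card_le_card_of_injective f hf
  rwa [Nat.card_sum, Nat.card_sum, ← two_mul] at this

theorem zpowers_injective_of_sq_eq_one {G : Type*} [Group G] (hG : ∀ g : G, g ^ 2 = 1) :
    Function.Injective (Subgroup.zpowers : G → Subgroup G) := by
  have key {g h : G} (hgh : h ∈ Subgroup.zpowers g) : h = 1 ∨ h = g := by
    obtain ⟨k, rfl⟩ := Subgroup.mem_zpowers_iff.mp hgh
    have hg : g ^ (2 : ℤ) = 1 := by exact_mod_cast hG g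
    rcases Int.even_or_odd' k with ⟨m, rfl | rfl⟩
    · simp [zpow_mul, hg]
    · simp [zpow_add, zpow_mul, hg]
  intro g h hgh
  rcases key (hgh ▸ Subgroup.mem_zpowers h : h ∈ Subgroup.zpowers g) with rfl | rfl
  · simpa using hgh
  · rfl

theorem numCyclic_eq_card_of_sq_eq_one {G : Type*} [Group G] (hG : ∀ g : G, g ^ 2 = 1) :
    numCyclic G = Nat.card G := by
  let f : G → {H : Subgroup G // IsCyclic (↥H)} := fun g => ⟨Subgroup.zpowers g, inferInstance⟩
  refine (Nat.card_eq_of_bijective f ⟨fun g h hgh => ?_, fun ⟨H, hH⟩ => ?_⟩).symm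
  · exact zpowers_injective_of_sq_eq_one hG (congrArg Subtype.val hgh)
  · obtain ⟨g, hg⟩ := (Subgroup.isCyclic_iff_exists_zpowers_eq_top H).mp hH
    exact ⟨g, Subtype.ext hg⟩

theorem stmt_2 (G : Type*) [Group G] [Fintype G] :
    alpha G ≤ 1 / 2 + (Nat.card {g : G // g ^ 2 = 1} : ℚ) / (2 * (Nat.card G : ℚ)) ∧
      (Nat.card {g : G // g ^ 2 = 1} : ℚ) / (Nat.card G : ℚ) ≥ 2 * alpha G - 1 ∧
      (alpha G = 1 ↔ ∀ g : G, g ^ 2 = 1) := by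
  have hle : 2 * (numCyclic G : ℚ) ≤ Nat.card G + Nat.card {g : G // g ^ 2 = 1} := by
    exact_mod_cast two_mul_numCyclic_le G
  have hpos : (0 : ℚ) < Nat.card G := by exact_mod_cast Nat.card_pos
  have hmain : 2 * alpha G - 1 ≤ (Nat.card {g : G // g ^ 2 = 1} : ℚ) / (Nat.card G : ℚ) := by
    rw [alpha, le_div_iff₀ hpos, sub_mul, mul_assoc, div_mul_cancel₀ _ hpos.ne']
    linarith
  refine ⟨?_, hmain, fun h => ?_, fun h => ?_⟩
  · rw [mul_comm, ← div_div]
    linarith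
  · rw [h, le_div_iff₀ hpos] at hmain
    have hcard : Nat.card G ≤ Nat.card {g : G // g ^ 2 = 1} := by
      have : (Nat.card G : ℚ) ≤ Nat.card {g : G // g ^ 2 = 1} := by linarith
      exact_mod_cast this
    have hbij := Subtype.val_injective (p := fun g : G => g ^ 2 = 1).bijective_of_nat_card_le hcard
    intro g
    obtain ⟨x, rfl⟩ := hbij.surjective g
    exact x.2
  · rw [alpha, numCyclic_eq_card_of_sq_eq_one h, div_self hpos.ne']
end

section
/- If N is a normal subgroup of a finite group G, then α(G) ≤ α(G/N); moreover, equality α(G) = α(G/N) holds if and only if φ(o(g)) = φ(o(gN)) for every g ∈ G, where o(gN) denotes the order of the element gN in G/N. -/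
open scoped Classical

/-- A finite cyclic subgroup `H` is generated by exactly `φ(|H|)` elements. -/
lemma card_filter_zpowers_eq {G : Type*} [Group G] [Fintype G] (H : Subgroup G)
    (hH : IsCyclic H) :
    (Finset.univ.filter fun g : G => Subgroup.zpowers g = H).card
      = Nat.totient (Nat.card H) := by
  rw [← IsCyclic.card_orderOf_eq_totient (α := H) (d := Nat.card H)
    (by rw [Nat.card_eq_fintype_card])]
  symm
  refine Finset.card_bij (fun a _ => (a : G)) ?_ (fun a _ b _ h => Subtype.ext h) ?_
  · intro a ha
    simp only [Finset.mem_filter, Finset.mem_univ, true_and] at ha ⊢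
    refine Subgroup.eq_of_le_of_card_ge ((Subgroup.zpowers_le).2 a.2) ?_
    rw [Nat.card_zpowers, Subgroup.orderOf_coe, ha]
  · intro b hb
    simp only [Finset.mem_filter, Finset.mem_univ, true_and] at hb
    refine ⟨⟨b, hb ▸ Subgroup.mem_zpowers b⟩, ?_, rfl⟩
    simp only [Finset.mem_filter, Finset.mem_univ, true_and]
    rw [Subgroup.orderOf_mk, ← hb, Nat.card_zpowers]

/-- The number of cyclic subgroups is the sum of `1 / φ(o(g))` over all elements. -/
lemma numCyclic_eq_sum (G : Type*) [Group G] [Fintype G] :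
    (numCyclic G : ℚ) = ∑ g : G, ((Nat.totient (orderOf g) : ℚ))⁻¹ := by
  let f : G → {H : Subgroup G // IsCyclic H} := fun g => ⟨Subgroup.zpowers g, inferInstance⟩
  rw [← Finset.sum_fiberwise Finset.univ f, numCyclic, Nat.card_eq_fintype_card,
    Fintype.card_eq_sum_ones, Nat.cast_sum]
  refine Finset.sum_congr rfl fun H _ => ?_
  have hpos : (Nat.totient (Nat.card H.1) : ℚ) ≠ 0 :=
    Nat.cast_ne_zero.2 (Nat.totient_pos.2 Nat.card_pos).ne'
  have hconst : ∀ g ∈ Finset.univ.filter (fun g => f g = H),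
      ((Nat.totient (orderOf g) : ℚ))⁻¹ = (Nat.totient (Nat.card H.1) : ℚ)⁻¹ := by
    intro g hg
    rw [← (Finset.mem_filter.1 hg).2, ← Nat.card_zpowers]
  have hcard : (Finset.univ.filter fun g => f g = H).card = Nat.totient (Nat.card H.1) := by
    rw [← card_filter_zpowers_eq H.1 H.2]
    simp only [f, Subtype.ext_iff]
  rw [Finset.sum_congr rfl hconst, Finset.sum_const, hcard, nsmul_eq_mul, mul_inv_cancel₀ hpos,
    Nat.cast_one]

/-- Summing over `G` a function of the cosets of `N` multiplies its sum by `|N|`. -/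
lemma sum_comp_quotient_mk {G : Type*} [Group G] [Fintype G] (N : Subgroup G)
    (f : G ⧸ N → ℚ) :
    ∑ g : G, f (g : G ⧸ N) = Nat.card N * ∑ x : G ⧸ N, f x := by
  rw [← Finset.sum_fiberwise Finset.univ (fun g : G => (g : G ⧸ N)), Finset.mul_sum]
  refine Finset.sum_congr rfl fun x _ => ?_
  have hconst : ∀ g ∈ Finset.univ.filter (fun g : G => (g : G ⧸ N) = x),
      f (g : G ⧸ N) = f x := fun g hg => by rw [(Finset.mem_filter.1 hg).2]
  have hcard : (Finset.univ.filter fun g : G => (g : G ⧸ N) = x).card = Nat.card N := by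
    have h := QuotientGroup.card_preimage_mk N {x}
    have hx : Nat.card ({x} : Set (G ⧸ N)) = 1 := Nat.card_unique
    rw [hx, mul_one] at h
    rw [← h, Nat.card_eq_fintype_card, Fintype.card_subtype]
    simp only [Set.mem_preimage, Set.mem_singleton_iff]
  rw [Finset.sum_congr rfl hconst, Finset.sum_const, hcard, nsmul_eq_mul]

theorem stmt_3 (G : Type*) [Group G] [Fintype G] (N : Subgroup G) [N.Normal] :
    alpha G ≤ alpha (G ⧸ N) ∧
      (alpha G = alpha (G ⧸ N) ↔
        ∀ g : G, Nat.totient (orderOf g) = Nat.totient (orderOf (g : G ⧸ N))) := by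
  have hGpos : (0 : ℚ) < Nat.card G := Nat.cast_pos.2 Nat.card_pos
  have hNpos : (0 : ℚ) < Nat.card N := Nat.cast_pos.2 Nat.card_pos
  have hQpos : (0 : ℚ) < Nat.card (G ⧸ N) := Nat.cast_pos.2 Nat.card_pos
  have hmul : (Nat.card G : ℚ) = Nat.card (G ⧸ N) * Nat.card N := by
    exact_mod_cast Subgroup.card_eq_card_quotient_mul_card_subgroup N
  have hG : alpha G = (∑ g : G, ((Nat.totient (orderOf g) : ℚ))⁻¹) / Nat.card G := by
    rw [alpha, numCyclic_eq_sum]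
  have hQ : alpha (G ⧸ N)
      = (∑ g : G, ((Nat.totient (orderOf (g : G ⧸ N)) : ℚ))⁻¹) / Nat.card G := by
    rw [alpha, numCyclic_eq_sum,
      sum_comp_quotient_mk N fun x => ((Nat.totient (orderOf x) : ℚ))⁻¹, hmul]
    field_simp
  have hle : ∀ g ∈ (Finset.univ : Finset G), ((Nat.totient (orderOf g) : ℚ))⁻¹
      ≤ ((Nat.totient (orderOf (g : G ⧸ N)) : ℚ))⁻¹ := by
    intro g _
    have hdvd : orderOf (g : G ⧸ N) ∣ orderOf g := orderOf_map_dvd (QuotientGroup.mk' N) g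
    refine inv_anti₀ (Nat.cast_pos.2 (Nat.totient_pos.2 (orderOf_pos _))) (Nat.cast_le.2 ?_)
    exact Nat.le_of_dvd (Nat.totient_pos.2 (orderOf_pos g)) (Nat.totient_dvd_of_dvd hdvd)
  rw [hG, hQ, div_left_inj' hGpos.ne', Finset.sum_eq_sum_iff_of_le hle]
  refine ⟨div_le_div_of_nonneg_right (Finset.sum_le_sum hle) hGpos.le, ?_⟩
  simp only [Finset.mem_univ, true_imp_iff, inv_inj, Nat.cast_inj]
end

section
/- For every finite group G, I(G)² ≤ k(G)·|G|; equivalently, cp(G) ≥ (I(G)/|G|)². -/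
open scoped Classical

/-- The number of pairs of elements squaring to one is at most the number of commuting pairs:
a pair `(x, y)` is determined by `z = x * y` and by `x`, which inverts `z` by conjugation, and
the elements inverting `z` lie in a single coset of the centralizer of `z`. -/
theorem card_sq_eq_one_sq_le_card_commute (G : Type*) [Group G] [Finite G] :
    (Nat.card {g : G // g ^ 2 = 1}) ^ 2 ≤ Nat.card {p : G × G // Commute p.1 p.2} := by
  have hex : ∀ z : G, ∃ t : G, (∃ x : G, x * z = z⁻¹ * x) → t * z = z⁻¹ * t := fun z => by
    by_cases h : ∃ x : G, x * z = z⁻¹ * x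
    · exact h.imp fun _ hx _ => hx
    · exact ⟨1, fun h' => absurd h' h⟩
  choose t ht using hex
  have hinv : ∀ x y : {g : G // g ^ 2 = 1},
      (x : G) * (x * y) = ((x : G) * y)⁻¹ * x := fun x y => by
    have hx : (x : G) * x = 1 := by rw [← sq]; exact x.2
    have hy : (y : G) * y = 1 := by rw [← sq]; exact y.2
    rw [← mul_assoc, hx, one_mul, mul_inv_rev, inv_mul_cancel_right]
    exact eq_inv_of_mul_eq_one_left hy
  rw [sq, ← Nat.card_prod]
  refine Nat.card_le_card_of_injective
    (fun p : {g : G // g ^ 2 = 1} × {g : G // g ^ 2 = 1} =>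
      (⟨((p.1 : G) * p.2, (t ((p.1 : G) * p.2))⁻¹ * p.1), ?_⟩ :
        {p : G × G // Commute p.1 p.2})) ?_
  · have hx := hinv p.1 p.2
    have h := ht _ ⟨_, hx⟩
    set z := (p.1 : G) * p.2
    change z * ((t z)⁻¹ * p.1) = (t z)⁻¹ * p.1 * z
    have h' : z * (t z)⁻¹ = (t z)⁻¹ * z⁻¹ := by
      rw [mul_inv_eq_iff_eq_mul, mul_assoc, ← h, inv_mul_cancel_left]
    rw [mul_assoc _ _ z, hx, ← mul_assoc z, h', mul_assoc]
  · rintro ⟨x, y⟩ ⟨x', y'⟩ h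
    simp only [Subtype.mk.injEq, Prod.mk.injEq] at h
    obtain ⟨hz, hxx⟩ := h
    rw [hz, mul_right_inj] at hxx
    rw [hxx, mul_right_inj] at hz
    exact Prod.ext (Subtype.ext hxx) (Subtype.ext hz)

theorem stmt_12 (G : Type*) [Group G] [Fintype G] :
    (Nat.card {g : G // g ^ 2 = 1}) ^ 2 ≤ Nat.card (ConjClasses G) * Nat.card G ∧
      (Nat.card (ConjClasses G) : ℚ) / (Nat.card G : ℚ) ≥
        ((Nat.card {g : G // g ^ 2 = 1} : ℚ) / (Nat.card G : ℚ)) ^ 2 := by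
  have h : (Nat.card {g : G // g ^ 2 = 1}) ^ 2 ≤ Nat.card (ConjClasses G) * Nat.card G :=
    (card_sq_eq_one_sq_le_card_commute G).trans_eq
      (card_comm_eq_card_conjClasses_mul_card G)
  refine ⟨h, ?_⟩
  have hG : (0 : ℚ) < Nat.card G := by exact_mod_cast Nat.card_pos
  have hq : (Nat.card {g : G // g ^ 2 = 1} : ℚ) ^ 2 ≤
      Nat.card (ConjClasses G) * Nat.card G := by exact_mod_cast h
  rw [ge_iff_le, div_pow, div_le_div_iff₀ (by positivity) hG]
  calc _ ≤ (Nat.card (ConjClasses G) * Nat.card G : ℚ) * Nat.card G := by gcongr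
    _ = _ := by ring
end
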